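/- arXiv:2403.07310 — 2 statements merged into one kernel-verified Lean document; each statement's English description precedes it below -/
import Mathlib

section
/- Let φ be the sigmoid function. For every fixed u ∈ ℝ, lim_{σ→0⁺} (β₀(u,σ) − α₀(u,σ)²)/σ⁴ = 1/128 + u²/64; that is, the small-variance expansion E_{z∼N(u,1)}[φ'(σ·z)²] − (E_{z∼N(u,1)}[φ'(σ·z)])² = (1/128 + u²/64)·σ⁴ + o(σ⁴) holds as σ → 0⁺. -/
open MeasureTheory ProbabilityTheory

/-- The sigmoid function `φ(x) = 1/(1 + exp(−x))`. -/
noncomputable def phi (x : ℝ) : ℝ := 1 / (1 + Real.exp (-x))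

/-- The derivative of the sigmoid, `φ' = φ(1−φ)`. -/
noncomputable def phi' (x : ℝ) : ℝ := phi x * (1 - phi x)

/-- `α_q(u,σ) = E_{z∼N(u,1)}[φ'(σ·z)·z^q]`. -/
noncomputable def alphaQ (q : ℕ) (u σ : ℝ) : ℝ :=
  ∫ z, phi' (σ * z) * z ^ q ∂(gaussianReal u 1)

/-- `β_q(u,σ) = E_{z∼N(u,1)}[φ'(σ·z)²·z^q]`. -/
noncomputable def betaQ (q : ℕ) (u σ : ℝ) : ℝ :=
  ∫ z, (phi' (σ * z)) ^ 2 * z ^ q ∂(gaussianReal u 1)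

lemma aux_deriv (u : ℝ) (P P' : ℝ → ℝ) (h : ∀ t, HasDerivAt P (P' t) t) :
    deriv (fun t => P t * Real.exp (u * t + t ^ 2 / 2)) =
      fun t => (P' t + P t * (u + t)) * Real.exp (u * t + t ^ 2 / 2) := by
  funext t
  have h1 : HasDerivAt (fun t : ℝ => u * t + t ^ 2 / 2) (u + t) t := by
    have := ((hasDerivAt_id t).const_mul u).add (((hasDerivAt_id t).pow 2).div_const 2)
    refine HasDerivAt.congr_deriv this ?_
    simp
  rw [((h t).fun_mul h1.exp).deriv]
  ring

lemma aux_iter (u : ℝ) :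
    iteratedDeriv 2 (fun t : ℝ => Real.exp (u * t + t ^ 2 / 2)) 0 = u ^ 2 + 1 ∧
    iteratedDeriv 4 (fun t : ℝ => Real.exp (u * t + t ^ 2 / 2)) 0 = u ^ 4 + 6 * u ^ 2 + 3 := by
  have hs : ∀ t : ℝ, HasDerivAt (fun t : ℝ => u + t) 1 t := fun t => (hasDerivAt_id t).const_add u
  have e1 : deriv (fun t : ℝ => Real.exp (u * t + t ^ 2 / 2)) =
      fun t => (u + t) * Real.exp (u * t + t ^ 2 / 2) := by
    have := aux_deriv u (fun _ => 1) (fun _ => 0) (fun t => hasDerivAt_const t _)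
    simpa using this
  have e2 := aux_deriv u (fun t => u + t) (fun _ => 1) hs
  have e3 := aux_deriv u (fun t => 1 + (u + t) * (u + t)) (fun t => 2 * (u + t)) (fun t => by
    refine HasDerivAt.congr_deriv (((hs t).mul (hs t)).const_add 1) ?_
    ring)
  have e4 := aux_deriv u (fun t => 2 * (u + t) + (1 + (u + t) * (u + t)) * (u + t))
    (fun t => 3 + 3 * (u + t) ^ 2) (fun t => by
    refine HasDerivAt.congr_deriv
      (((hs t).const_mul 2).add ((((hs t).fun_mul (hs t)).const_add 1).fun_mul (hs t))) ?_
    ring)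
  have i2 : iteratedDeriv 2 (fun t : ℝ => Real.exp (u * t + t ^ 2 / 2)) =
      fun t => (1 + (u + t) * (u + t)) * Real.exp (u * t + t ^ 2 / 2) := by
    rw [iteratedDeriv_succ, iteratedDeriv_one, e1, e2]
  refine ⟨?_, ?_⟩
  · rw [i2]; simp; ring
  · rw [iteratedDeriv_succ, iteratedDeriv_succ, i2, e3, e4]; simp; ring

lemma aux_moments (u : ℝ) :
    ∫ z, z ^ 2 ∂(gaussianReal u 1) = u ^ 2 + 1 ∧
    ∫ z, z ^ 4 ∂(gaussianReal u 1) = u ^ 4 + 6 * u ^ 2 + 3 := by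
  have h0 : (0 : ℝ) ∈ interior (integrableExpSet id (gaussianReal u 1)) := by simp
  have h2 := iteratedDeriv_mgf_zero h0 2
  have h4 := iteratedDeriv_mgf_zero h0 4
  rw [mgf_id_gaussianReal] at h2 h4
  have := aux_iter u
  simp only [NNReal.coe_one, one_mul] at h2 h4
  rw [this.1] at h2
  rw [this.2] at h4
  exact ⟨by simpa using h2.symm, by simpa using h4.symm⟩

lemma aux_int (u : ℝ) (n : ℕ) : Integrable (fun z : ℝ => z ^ n) (gaussianReal u 1) := by
  have h0 : (0 : ℝ) ∈ interior (integrableExpSet id (gaussianReal u 1)) := by simp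
  simpa using integrable_pow_of_mem_interior_integrableExpSet h0 n

lemma aux_bound (x : ℝ) : |Real.sigmoid x - 1 / 2| ≤ |x| := by
  have := Convex.norm_image_sub_le_of_norm_hasDerivWithin_le (f := Real.sigmoid)
    (f' := fun x => Real.sigmoid x * (1 - Real.sigmoid x)) (C := 1) (s := Set.univ)
    (x := 0) (y := x) (fun x _ => (Real.hasDerivAt_sigmoid x).hasDerivWithinAt)
    (fun x _ => by
      have h1 := Real.sigmoid_pos x
      have h2 := Real.sigmoid_lt_one x
      rw [Real.norm_eq_abs, abs_le]
      constructor <;> nlinarith) convex_univ trivial trivial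
  simpa [Real.sigmoid_zero] using this

lemma aux_lim (z : ℝ) : Filter.Tendsto (fun σ : ℝ => (Real.sigmoid (σ * z) - 1 / 2) / σ)
    (nhdsWithin 0 (Set.Ioi 0)) (nhds (z / 4)) := by
  have h : HasDerivAt (fun σ : ℝ => Real.sigmoid (σ * z)) (z / 4) 0 := by
    have h1 : HasDerivAt (fun σ : ℝ => σ * z) z 0 := by
      simpa using (hasDerivAt_id (0 : ℝ)).mul_const z
    have h2 := HasDerivAt.comp (0 : ℝ) (Real.hasDerivAt_sigmoid ((0 : ℝ) * z)) h1
    refine HasDerivAt.congr_deriv h2 ?_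
    simp [Real.sigmoid_zero]; ring
  have := h.tendsto_slope_zero_right
  refine this.congr (fun σ => ?_)
  simp [Real.sigmoid_zero]; ring

lemma aux_phi (x : ℝ) : phi' x = 1 / 4 - (Real.sigmoid x - 1 / 2) ^ 2 := by
  have : phi x = Real.sigmoid x := by simp [phi, Real.sigmoid_def]
  rw [phi', this]; ring

/-- Rescaled quantity. -/
noncomputable def gg (σ z : ℝ) : ℝ := (Real.sigmoid (σ * z) - 1 / 2) / σ

lemma gg_cont (σ : ℝ) : Continuous (gg σ) := by
  unfold gg
  have := continuous_sigmoid
  fun_prop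

lemma gg_bound (σ z : ℝ) (h : 0 < σ) : |gg σ z| ≤ |z| := by
  unfold gg
  rw [abs_div, abs_of_pos h, div_le_iff₀ h]
  have := aux_bound (σ * z)
  rwa [abs_mul, abs_of_pos h, mul_comm σ |z|] at this

lemma gg_pow_bound (σ z : ℝ) (h : 0 < σ) (n : ℕ) (hn : Even n) : ‖gg σ z ^ n‖ ≤ z ^ n := by
  rw [norm_pow, Real.norm_eq_abs, ← hn.pow_abs z]
  exact pow_le_pow_left₀ (abs_nonneg _) (gg_bound σ z h) n

lemma gg_int (u σ : ℝ) (h : 0 < σ) (n : ℕ) (hn : Even n) :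
    Integrable (fun z => gg σ z ^ n) (gaussianReal u 1) :=
  (aux_int u n).mono' ((gg_cont σ).pow n).aestronglyMeasurable
    (Filter.Eventually.of_forall fun z => gg_pow_bound σ z h n hn)

lemma gg_lim (u : ℝ) (n : ℕ) (hn : Even n) :
    Filter.Tendsto (fun σ : ℝ => ∫ z, gg σ z ^ n ∂(gaussianReal u 1))
      (nhdsWithin 0 (Set.Ioi 0)) (nhds (∫ z, (z / 4) ^ n ∂(gaussianReal u 1))) := by
  refine tendsto_integral_filter_of_dominated_convergence (fun z => z ^ n) ?_ ?_ (aux_int u n) ?_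
  · exact Filter.Eventually.of_forall fun σ => ((gg_cont σ).pow n).aestronglyMeasurable
  · filter_upwards [self_mem_nhdsWithin] with σ hσ
    exact Filter.Eventually.of_forall fun z => gg_pow_bound σ z hσ n hn
  · exact Filter.Eventually.of_forall fun z => (aux_lim z).pow n

theorem stmt_4 (u : ℝ) :
    Filter.Tendsto (fun σ : ℝ => (betaQ 0 u σ - (alphaQ 0 u σ) ^ 2) / σ ^ 4)
      (nhdsWithin 0 (Set.Ioi 0)) (nhds (1 / 128 + u ^ 2 / 64)) := by
  have h2 := gg_lim u 2 (by decide)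
  have h4 := gg_lim u 4 (by decide)
  simp only [div_pow, integral_div, (aux_moments u).1, (aux_moments u).2] at h2 h4
  have h := h4.sub (h2.pow 2)
  have e : (u ^ 4 + 6 * u ^ 2 + 3) / 4 ^ 4 - ((u ^ 2 + 1) / 4 ^ 2) ^ 2 = 1 / 128 + u ^ 2 / 64 := by
    ring
  rw [e] at h
  refine h.congr' ?_
  filter_upwards [self_mem_nhdsWithin] with σ hσ
  have hσ : 0 < σ := hσ
  have i2 := gg_int u σ hσ 2 (by decide)
  have i4 := gg_int u σ hσ 4 (by decide)
  have hp : ∀ z, phi' (σ * z) = 1 / 4 - σ ^ 2 * gg σ z ^ 2 := fun z => by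
    rw [aux_phi, gg]; field_simp
  have ha : alphaQ 0 u σ = 1 / 4 - σ ^ 2 * ∫ z, gg σ z ^ 2 ∂(gaussianReal u 1) := by
    simp only [alphaQ, hp, pow_zero, mul_one]
    rw [integral_sub (integrable_const _) (i2.const_mul _), integral_const_mul]
    simp
  have hb : betaQ 0 u σ = 1 / 16 - σ ^ 2 / 2 * (∫ z, gg σ z ^ 2 ∂(gaussianReal u 1))
      + σ ^ 4 * ∫ z, gg σ z ^ 4 ∂(gaussianReal u 1) := by
    have : ∀ z, (1 / 4 - σ ^ 2 * gg σ z ^ 2) ^ 2 =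
      1 / 16 - σ ^ 2 / 2 * gg σ z ^ 2 + σ ^ 4 * gg σ z ^ 4 := fun z => by ring
    simp only [betaQ, hp, pow_zero, mul_one, this]
    have i1 : Integrable (fun z => 1 / 16 - σ ^ 2 / 2 * gg σ z ^ 2) (gaussianReal u 1) :=
      (integrable_const _).sub (i2.const_mul _)
    rw [integral_add i1 (i4.const_mul _),
      integral_sub (integrable_const _) (i2.const_mul _), integral_const_mul, integral_const_mul]
    simp
  rw [ha, hb]
  field_simp
  ring
end

section
/- Let φ be the sigmoid function. For every fixed σ > 0 and every ε > 0, there exist c > 0 and u₀ > 0 such that for all u ∈ ℝ with |u| ≥ u₀, both β₀(u,σ) − α₀(u,σ)² ≥ c · e^{−u²/2} · |u|^{−(1+ε)} and β₂(u,σ) − α₂(u,σ)²/(u² + 1) ≥ c · e^{−u²/2} · |u|^{−(3+ε)} hold. -/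
open MeasureTheory ProbabilityTheory

lemma aux_phi'_eq (x : ℝ) : phi' x = 1 / (2 + 2 * Real.cosh x) := by
  unfold phi' phi
  rw [Real.cosh_eq, Real.exp_neg]
  have := Real.exp_pos x
  field_simp
  ring

lemma aux_phi'_nonneg (x : ℝ) : 0 ≤ phi' x := by
  rw [aux_phi'_eq]
  have := Real.cosh_pos x
  positivity

lemma aux_phi'_le (x : ℝ) : phi' x ≤ 1 := by
  rw [aux_phi'_eq, div_le_one (by have := Real.cosh_pos x; positivity)]
  linarith [Real.cosh_pos x]

lemma aux_phi'_cont : Continuous phi' := by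
  have : phi' = fun x => 1 / (2 + 2 * Real.cosh x) := funext aux_phi'_eq
  rw [this]
  refine continuous_const.div (by fun_prop) (fun x => ?_)
  have := Real.cosh_pos x
  positivity

lemma aux_phi'_neg (x : ℝ) : phi' (-x) = phi' x := by
  simp [aux_phi'_eq]

lemma aux_phi'_anti {x y : ℝ} (hx : 0 ≤ x) (hxy : x ≤ y) : phi' y ≤ phi' x := by
  rw [aux_phi'_eq, aux_phi'_eq]
  have h : Real.cosh x ≤ Real.cosh y := by
    rw [Real.cosh_le_cosh, abs_of_nonneg hx, abs_of_nonneg (hx.trans hxy)]; exact hxy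
  have := Real.cosh_pos x
  gcongr

lemma aux_phi'_strict {x y : ℝ} (hx : 0 ≤ x) (hxy : x < y) : phi' y < phi' x := by
  rw [aux_phi'_eq, aux_phi'_eq]
  have h : Real.cosh x < Real.cosh y := by
    rw [Real.cosh_lt_cosh, abs_of_nonneg hx, abs_of_nonneg (hx.trans hxy.le)]; exact hxy
  have := Real.cosh_pos x
  gcongr

lemma aux_int_pow (q : ℕ) (u : ℝ) : Integrable (fun z : ℝ => z ^ q) (gaussianReal u 1) := by
  have := (memLp_id_gaussianReal (μ := u) (v := 1) q).integrable_norm_pow'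
  refine Integrable.mono this (by fun_prop) ?_
  filter_upwards with z
  simp

lemma aux_int1 (q : ℕ) (u σ : ℝ) :
    Integrable (fun z : ℝ => phi' (σ * z) * z ^ q) (gaussianReal u 1) := by
  have hc := aux_phi'_cont
  refine Integrable.mono (aux_int_pow q u) (by fun_prop) ?_
  filter_upwards with z
  rw [norm_mul, Real.norm_of_nonneg (aux_phi'_nonneg _)]
  exact mul_le_of_le_one_left (norm_nonneg _) (aux_phi'_le _)

lemma aux_int2 (q : ℕ) (u σ : ℝ) :
    Integrable (fun z : ℝ => phi' (σ * z) ^ 2 * z ^ q) (gaussianReal u 1) := by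
  have hc := aux_phi'_cont
  refine Integrable.mono (aux_int_pow q u) (by fun_prop) ?_
  filter_upwards with z
  rw [norm_mul, norm_pow, Real.norm_of_nonneg (aux_phi'_nonneg _)]
  exact mul_le_of_le_one_left (norm_nonneg _)
    (pow_le_one₀ (aux_phi'_nonneg _) (aux_phi'_le _))

lemma aux_expand (q : ℕ) (u σ m : ℝ) :
    Integrable (fun z : ℝ => (phi' (σ * z) - m) ^ 2 * z ^ q) (gaussianReal u 1) ∧
    ∫ z, (phi' (σ * z) - m) ^ 2 * z ^ q ∂(gaussianReal u 1) =
      betaQ q u σ - 2 * m * alphaQ q u σ + m ^ 2 * ∫ z, z ^ q ∂(gaussianReal u 1) := by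
  have e : (fun z : ℝ => (phi' (σ * z) - m) ^ 2 * z ^ q) = fun z : ℝ =>
      (phi' (σ * z) ^ 2 * z ^ q - 2 * m * (phi' (σ * z) * z ^ q)) + m ^ 2 * z ^ q := by
    ext z; ring
  have h1 := aux_int1 q u σ
  have h2 := aux_int2 q u σ
  have h3 := aux_int_pow q u
  rw [e]
  refine ⟨(h2.sub (h1.const_mul _)).add (h3.const_mul _), ?_⟩
  have h4 : Integrable (fun z : ℝ => phi' (σ * z) ^ 2 * z ^ q -
      2 * m * (phi' (σ * z) * z ^ q)) (gaussianReal u 1) := h2.sub (h1.const_mul _)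
  rw [integral_add h4 (h3.const_mul _),
    integral_sub h2 (h1.const_mul _), integral_const_mul, integral_const_mul]
  rfl

lemma aux_gauss (u a : ℝ) (hu : 1 ≤ u) (ha : 0 ≤ a) (ha' : a + 1 / 4 ≤ 1) :
    (1 / 4) * ((Real.sqrt (2 * Real.pi))⁻¹ * Real.exp (-u ^ 2 / 2)) ≤
      (gaussianReal u 1).real (Set.Icc a (a + 1 / 4)) := by
  rw [measureReal_def, gaussianReal_apply_eq_integral _ one_ne_zero, ENNReal.toReal_ofReal
    (integral_nonneg fun z => gaussianPDFReal_nonneg _ _ _)]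
  have := setIntegral_ge_of_const_le_real (μ := volume) (s := Set.Icc a (a + 1 / 4))
    (f := gaussianPDFReal u 1)
    (c := (Real.sqrt (2 * Real.pi))⁻¹ * Real.exp (-u ^ 2 / 2)) measurableSet_Icc (by simp)
    (fun z hz => ?_) (integrable_gaussianPDFReal u 1).integrableOn
  · refine le_trans (le_of_eq ?_) this
    simp [measureReal_def]
    ring
  · obtain ⟨h1, h2⟩ := hz
    simp only [gaussianPDFReal, NNReal.coe_one, mul_one]
    refine mul_le_mul_of_nonneg_left (Real.exp_le_exp.mpr ?_) (by positivity)
    nlinarith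

lemma aux_core (q : ℕ) (hq : Even q) (hq2 : q ≤ 2) (u σ m δ : ℝ) (hσ : 0 < σ) (hu : 1 ≤ u)
    (hδ : 0 < δ) (hδ' : 2 * δ = phi' (σ * (1 / 2)) - phi' (σ * (3 / 4))) :
    δ ^ 2 / 16 * ((1 / 4) * ((Real.sqrt (2 * Real.pi))⁻¹ * Real.exp (-u ^ 2 / 2))) ≤
      ∫ z, (phi' (σ * z) - m) ^ 2 * z ^ q ∂(gaussianReal u 1) := by
  have hint := (aux_expand q u σ m).1
  have hnn : ∀ z : ℝ, 0 ≤ (phi' (σ * z) - m) ^ 2 * z ^ q := fun z =>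
    mul_nonneg (sq_nonneg _) (hq.pow_nonneg z)
  have key : ∃ a : ℝ, 1 / 4 ≤ a ∧ a + 1 / 4 ≤ 1 ∧
      ∀ z ∈ Set.Icc a (a + 1 / 4), δ ^ 2 ≤ (phi' (σ * z) - m) ^ 2 := by
    rcases le_total m ((phi' (σ * (1 / 2)) + phi' (σ * (3 / 4))) / 2) with h | h
    · refine ⟨1 / 4, le_rfl, by norm_num, fun z hz => ?_⟩
      have : phi' (σ * (1 / 2)) ≤ phi' (σ * z) := by
        apply aux_phi'_anti
        · have := hz.1; exact mul_nonneg hσ.le (by linarith)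
        · have := hz.2; gcongr; linarith
      nlinarith
    · refine ⟨3 / 4, by norm_num, by norm_num, fun z hz => ?_⟩
      have : phi' (σ * z) ≤ phi' (σ * (3 / 4)) := by
        apply aux_phi'_anti
        · positivity
        · have := hz.1; gcongr
      nlinarith
  obtain ⟨a, ha1, ha2, hz⟩ := key
  calc _ ≤ δ ^ 2 / 16 * (gaussianReal u 1).real (Set.Icc a (a + 1 / 4)) := by
        gcongr
        exact aux_gauss u a hu (by linarith) ha2
    _ ≤ ∫ z in Set.Icc a (a + 1 / 4), (phi' (σ * z) - m) ^ 2 * z ^ q ∂(gaussianReal u 1) := by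
        refine setIntegral_ge_of_const_le_real measurableSet_Icc (measure_ne_top _ _)
          (fun z hzm => ?_) hint.integrableOn
        have h4 : 1 / 4 ≤ z := ha1.trans hzm.1
        have h5 : z ≤ 1 := hzm.2.trans ha2
        have : (1 / 16 : ℝ) ≤ z ^ q := by
          calc (1 / 16 : ℝ) ≤ z ^ 2 := by nlinarith
            _ ≤ z ^ q := pow_le_pow_of_le_one (by linarith) h5 hq2
        calc δ ^ 2 / 16 = δ ^ 2 * (1 / 16) := by ring
          _ ≤ _ := mul_le_mul (hz z hzm) this (by norm_num) (sq_nonneg _)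
    _ ≤ _ := setIntegral_le_integral hint (Filter.Eventually.of_forall hnn)

lemma aux_neg (u : ℝ) (f : ℝ → ℝ) (hf : Continuous f) (he : ∀ z, f (-z) = f z) :
    ∫ z, f z ∂(gaussianReal (-u) 1) = ∫ z, f z ∂(gaussianReal u 1) := by
  rw [← gaussianReal_map_neg, integral_map (by fun_prop) (by fun_prop)]
  simp [he]

lemma aux_alpha_abs (q : ℕ) (hq : Even q) (u σ : ℝ) : alphaQ q u σ = alphaQ q |u| σ := by
  have hc := aux_phi'_cont
  rcases abs_choice u with h | h <;> rw [h]
  unfold alphaQ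
  rw [aux_neg u _ (by fun_prop)]
  intro z
  rw [mul_neg, aux_phi'_neg, hq.neg_pow]

lemma aux_beta_abs (q : ℕ) (hq : Even q) (u σ : ℝ) : betaQ q u σ = betaQ q |u| σ := by
  have hc := aux_phi'_cont
  rcases abs_choice u with h | h <;> rw [h]
  unfold betaQ
  rw [aux_neg u _ (by fun_prop)]
  intro z
  rw [mul_neg, aux_phi'_neg, hq.neg_pow]

lemma aux_sq (u : ℝ) : ∫ z, z ^ 2 ∂(gaussianReal u 1) = u ^ 2 + 1 := by
  have h := variance_eq_sub (memLp_id_gaussianReal (μ := u) (v := 1) 2)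
  rw [variance_id_gaussianReal] at h
  simp only [Pi.pow_apply, id, integral_id_gaussianReal, NNReal.coe_one] at h
  linarith

lemma aux_rpow (c u p : ℝ) (hc : 0 ≤ c) (hu : 1 ≤ |u|) (hp : 0 ≤ p) :
    c * Real.exp (-u ^ 2 / 2) * |u| ^ (-p) ≤ c * Real.exp (-u ^ 2 / 2) :=
  mul_le_of_le_one_right (by positivity) (Real.rpow_le_one_of_one_le_of_nonpos hu (by linarith))

theorem stmt_11 (σ : ℝ) (hσ : 0 < σ) (ε : ℝ) (hε : 0 < ε) :
    ∃ c > 0, ∃ u₀ > 0, ∀ u : ℝ, u₀ ≤ |u| →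
      betaQ 0 u σ - (alphaQ 0 u σ) ^ 2 ≥
        c * Real.exp (-u ^ 2 / 2) * |u| ^ (-(1 + ε)) ∧
      betaQ 2 u σ - (alphaQ 2 u σ) ^ 2 / (u ^ 2 + 1) ≥
        c * Real.exp (-u ^ 2 / 2) * |u| ^ (-(3 + ε)) := by
  obtain ⟨δ, hδ'⟩ : ∃ δ : ℝ, 2 * δ = phi' (σ * (1 / 2)) - phi' (σ * (3 / 4)) :=
    ⟨(phi' (σ * (1 / 2)) - phi' (σ * (3 / 4))) / 2, by ring⟩
  have hδ : 0 < δ := by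
    have : phi' (σ * (3 / 4)) < phi' (σ * (1 / 2)) :=
      aux_phi'_strict (by positivity) (mul_lt_mul_of_pos_left (by norm_num) hσ)
    linarith
  have hpi := Real.pi_pos
  refine ⟨δ ^ 2 / 16 * ((1 / 4) * (Real.sqrt (2 * Real.pi))⁻¹), by positivity, 1, one_pos, ?_⟩
  intro u hu
  constructor
  · refine (aux_rpow _ u _ (by positivity) hu (by positivity)).trans ?_
    have h := aux_core 0 (by simp) (by simp) |u| σ (alphaQ 0 |u| σ) δ hσ hu hδ hδ'
    rw [(aux_expand _ _ _ _).2] at h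
    simp only [pow_zero, integral_const, probReal_univ, smul_eq_mul, sq_abs] at h
    rw [aux_alpha_abs 0 (by simp) u, aux_beta_abs 0 (by simp) u]
    linarith
  · refine (aux_rpow _ u _ (by positivity) hu (by positivity)).trans ?_
    have h := aux_core 2 (by simp) (by simp) |u| σ (alphaQ 2 |u| σ / (u ^ 2 + 1)) δ hσ hu hδ hδ'
    rw [(aux_expand _ _ _ _).2, aux_sq] at h
    simp only [sq_abs] at h
    rw [aux_alpha_abs 2 (by simp) u, aux_beta_abs 2 (by simp) u]
    have hp : (0 : ℝ) < u ^ 2 + 1 := by positivity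
    have e : betaQ 2 |u| σ - 2 * (alphaQ 2 |u| σ / (u ^ 2 + 1)) * alphaQ 2 |u| σ +
        (alphaQ 2 |u| σ / (u ^ 2 + 1)) ^ 2 * (u ^ 2 + 1) =
        betaQ 2 |u| σ - (alphaQ 2 |u| σ) ^ 2 / (u ^ 2 + 1) := by
      field_simp
      ring
    rw [e] at h
    linarith
end
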